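/- arXiv:1903.01482 — 3 statements merged into one kernel-verified Lean document; each statement's English description precedes it below -/
import Mathlib

section
/- Let G = (V,E) be a finite simple connected bipartite undirected graph containing a cycle of length ḡ, with bipartition classes A and B, and let K : V → ℝ satisfy Σ_{a∈A} K(a) = Σ_{b∈B} K(b). Then there exists c : E → ℝ solving the constraint system for K and satisfying both ‖c‖₂² ≤ ḡ·|V|²·‖K‖² + (|V| − ḡ)·(|V| − ḡ + 1)²·‖K‖² and ‖c‖₂² ≤ |V|·‖K‖₁². -/
open scoped Classical
noncomputable section

namespace CS

variable {V : Type*} [Fintype V] [DecidableEq V]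

/-- `c`, a real function on the edges of `H`, solves the constraint system for `K`:
for every vertex `v`, the sum of `c` over the edges incident to `v` equals `-K v`. -/
def Solves (H : SimpleGraph V) (K : V → ℝ) (c : H.edgeFinset → ℝ) : Prop :=
  ∀ v : V, ∑ e : H.edgeFinset, (if v ∈ (e : Sym2 V) then c e else 0) = -K v

/-- `‖c‖₂²`, the sum of squares of the values of `c` over the edges. -/
def norm2 (H : SimpleGraph V) (c : H.edgeFinset → ℝ) : ℝ :=
  ∑ e : H.edgeFinset, c e ^ 2

/-- `‖K‖ = max_v |K v|`. -/
def kmax (K : V → ℝ) : ℝ := ⨆ v, |K v|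

/-- In a connected graph every vertex other than `r` has a neighbour strictly closer to `r`. -/
theorem exists_adj_dist_lt {W : Type*} {H : SimpleGraph W} (hH : H.Connected) {v r : W}
    (hv : v ≠ r) : ∃ w, H.Adj v w ∧ H.dist w r < H.dist v r := by
  obtain ⟨p, hp⟩ := hH.exists_walk_length_eq_dist v r
  cases p with
  | nil => exact absurd rfl hv
  | @cons _ w _ h q =>
    refine ⟨w, h, ?_⟩
    have := SimpleGraph.dist_le q
    rw [SimpleGraph.Walk.length_cons] at hp
    omega

/-- A connected graph with a connected induced subgraph on `C ∋ r` has a spanning tree rooted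
at `r`, given by a parent function along which a height decreases, whose restriction to `C` is
again a tree rooted at `r`. -/
theorem exists_parent {W : Type*} {G : SimpleGraph W} (hG : G.Connected)
    {C : Finset W}
    (hC : (G.induce (C : Set W)).Connected) {r : W} (hr : r ∈ C) :
    ∃ (p : W → W) (h : W → ℕ), (∀ v, v ≠ r → G.Adj v (p v) ∧ h (p v) < h v) ∧
      ∀ v ∈ C, v ≠ r → p v ∈ C := by
  let d : ↥(C : Set W) → ℕ := fun v => (G.induce (C : Set W)).dist v ⟨r, hr⟩
  let M : ℕ := ∑ v, d v + 1
  have hdM : ∀ v, d v < M := fun v =>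
    Nat.lt_succ_of_le (Finset.single_le_sum (f := d) (fun _ _ => Nat.zero_le _)
      (Finset.mem_univ v))
  let h : W → ℕ := fun v => if hv : v ∈ (C : Set W) then d ⟨v, hv⟩ else M + G.dist v r
  have key : ∀ v, ∃ w, v ≠ r → (G.Adj v w ∧ h w < h v) ∧ (v ∈ C → w ∈ C) := by
    intro v
    by_cases hvr : v = r
    · exact ⟨v, fun hne => absurd hvr hne⟩
    by_cases hv : v ∈ (C : Set W)
    · obtain ⟨w, hadj, hlt⟩ := exists_adj_dist_lt hC (v := ⟨v, hv⟩) (r := ⟨r, hr⟩)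
        (fun e => hvr (congrArg Subtype.val e))
      refine ⟨w, fun _ => ⟨⟨hadj, ?_⟩, fun _ => w.2⟩⟩
      simp only [h, dif_pos hv, dif_pos w.2]
      exact hlt
    · obtain ⟨w, hadj, hlt⟩ := exists_adj_dist_lt hG hvr
      refine ⟨w, fun _ => ⟨⟨hadj, ?_⟩, fun hvC => absurd hvC hv⟩⟩
      by_cases hw : w ∈ (C : Set W)
      · simp only [h, dif_neg hv, dif_pos hw]
        exact Nat.lt_of_lt_of_le (hdM _) (Nat.le_add_right _ _)
      · simp only [h, dif_neg hv, dif_neg hw]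
        omega
  choose p hp using key
  exact ⟨p, h, fun v hv => (hp v hv).1, fun v hvC hv => (hp v hv).2 hvC⟩

/-- In a rooted tree, the indicator of the path from `u` to the root `r`: it carries one unit
of flow from `u` to `r`. -/
theorem exists_unit_flow {p : V → V} {h : V → ℕ} {r : V} (hh : ∀ v, v ≠ r → h (p v) < h v)
    {C : Finset V} (hC : ∀ v ∈ C, v ≠ r → p v ∈ C) (hr : r ∈ C) (u : V) :
    ∃ φ : V → ℝ, (∀ v, 0 ≤ φ v ∧ φ v ≤ 1) ∧ (∀ v, φ v ≠ 0 → h v ≤ h u) ∧ φ r = 1 ∧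
      (∀ v, φ v = (if u = v then 1 else 0) + ∑ w, if w ≠ r ∧ p w = v then φ w else 0) ∧
      (u ∈ C → ∀ v ∉ C, φ v = 0) := by
  induction hn : h u using Nat.strong_induction_on generalizing u with
  | _ n ih =>
  subst hn
  by_cases hu : u = r
  · subst hu
    refine ⟨fun v => if u = v then 1 else 0, ?_, ?_, by simp, ?_, ?_⟩
    · intro v; dsimp only; split_ifs <;> norm_num
    · intro v hv
      by_cases e : u = v
      · rw [e]
      · simp [e] at hv
    · intro v
      rw [Finset.sum_eq_zero, add_zero]
      intro w _
      by_cases e : u = w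
      · simp [e]
      · simp [e]
    · intro _ v hv
      exact if_neg fun e : u = v => hv (e ▸ hr)
  · obtain ⟨φ, h01, hsupp, hroot, hdiv, hφC⟩ := ih _ (hh u hu) (p u) rfl
    have hlt := hh u hu
    have hφu : φ u = 0 := by
      by_contra hne
      have := hsupp u hne
      omega
    refine ⟨fun v => (if u = v then 1 else 0) + φ v, ?_, ?_, ?_, ?_, ?_⟩
    · intro v
      by_cases e : u = v
      · subst e; simp [hφu]
      · simpa [e] using h01 v
    · intro v hv
      by_cases e : u = v
      · rw [e]
      · have := hsupp v (by simpa [e] using hv)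
        omega
    · simp [hu, hroot]
    · intro v
      have hsplit : (∑ w, if w ≠ r ∧ p w = v then (if u = w then 1 else 0) + φ w else 0)
          = (if p u = v then 1 else 0) + ∑ w, if w ≠ r ∧ p w = v then φ w else 0 := by
        have : (if p u = v then (1 : ℝ) else 0)
            = ∑ w, if u = w then (if p w = v then 1 else 0) else 0 := by simp
        rw [this, ← Finset.sum_add_distrib]
        refine Finset.sum_congr rfl fun w _ => ?_
        by_cases e : u = w
        · subst e; by_cases e' : p u = v <;> simp [hu, e']
        · simp [e]
      dsimp only
      rw [hsplit, ← hdiv v]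
    · intro huC v hv
      have : u ≠ v := by rintro rfl; exact hv huC
      simp [this, hφC (hC u huC hu) v hv]

/-- In a rooted tree, the flow `f` towards the root with sources `x` of total zero, where `f v`
is the amount leaving `v` towards its parent. -/
theorem exists_tree_flow {p : V → V} {h : V → ℕ} {r : V} (hh : ∀ v, v ≠ r → h (p v) < h v)
    {C : Finset V} (hC : ∀ v ∈ C, v ≠ r → p v ∈ C) (hr : r ∈ C) (x : V → ℝ)
    (hx : ∑ v, x v = 0) :
    ∃ f : V → ℝ, f r = 0 ∧ (∀ v, f v = x v + ∑ w, if w ≠ r ∧ p w = v then f w else 0) ∧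
      (∀ v, |f v| ≤ ∑ u, |x u|) ∧ ∀ v ∉ C, |f v| ≤ ∑ u ∈ Cᶜ, |x u| := by
  choose φ h01 _ hroot hdiv hφC using exists_unit_flow hh hC hr
  have habs : ∀ u v, |x u * φ u v| ≤ |x u| := fun u v => by
    rw [abs_mul, abs_of_nonneg (h01 u v).1]
    exact mul_le_of_le_one_right (abs_nonneg _) (h01 u v).2
  refine ⟨fun v => ∑ u, x u * φ u v, by simp [hroot, hx], ?_, ?_, ?_⟩
  · intro v
    have hswap : (∑ w, if w ≠ r ∧ p w = v then ∑ u, x u * φ u w else 0)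
        = ∑ u, x u * ∑ w, if w ≠ r ∧ p w = v then φ u w else 0 := by
      simp_rw [Finset.mul_sum]
      rw [Finset.sum_comm]
      refine Finset.sum_congr rfl fun w _ => ?_
      split_ifs <;> simp
    have hxv : x v = ∑ u, x u * (if u = v then 1 else 0) := by simp
    calc ∑ u, x u * φ u v
        = ∑ u, (x u * (if u = v then 1 else 0)
            + x u * ∑ w, if w ≠ r ∧ p w = v then φ u w else 0) :=
          Finset.sum_congr rfl fun u _ => by rw [← mul_add, ← hdiv u v]
      _ = _ := by rw [Finset.sum_add_distrib, ← hxv, hswap]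
  · exact fun v => (Finset.abs_sum_le_sum_abs _ _).trans (Finset.sum_le_sum fun u _ => habs u v)
  · intro v hv
    have : ∑ u, x u * φ u v = ∑ u ∈ Cᶜ, x u * φ u v := by
      refine (Finset.sum_subset (Finset.subset_univ _) fun u _ hu => ?_).symm
      rw [hφC u (by simpa using hu) v hv, mul_zero]
    dsimp only
    rw [this]
    exact (Finset.abs_sum_le_sum_abs _ _).trans (Finset.sum_le_sum fun u _ => habs u v)

/-- A function on the non-root vertices of a rooted tree, transported to the edges of the graph
through `v ↦ s(v, p v)`: the incidence sums and the sum of squares. -/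
theorem exists_edge_function {G : SimpleGraph V} {p : V → V} {h : V → ℕ} {r : V}
    (hp : ∀ v, v ≠ r → G.Adj v (p v) ∧ h (p v) < h v) (y : V → ℝ) (hy : y r = 0) :
    ∃ c : G.edgeFinset → ℝ,
      (∀ v, ∑ e : G.edgeFinset, (if v ∈ (e : Sym2 V) then c e else 0)
        = y v + ∑ w, if w ≠ r ∧ p w = v then y w else 0) ∧
      norm2 G c = ∑ v, y v ^ 2 := by
  let ε : {v // v ≠ r} → G.edgeFinset := fun v =>
    ⟨s(v.1, p v.1), by simpa using (hp v.1 v.2).1⟩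
  have hε : Function.Injective ε := by
    intro v w hvw
    have hs : s(v.1, p v.1) = s(w.1, p w.1) := congrArg Subtype.val hvw
    rcases Sym2.eq_iff.mp hs with ⟨h1, _⟩ | ⟨h1, h2⟩
    · exact Subtype.ext h1
    · have hv := (hp v.1 v.2).2
      have hw := (hp w.1 w.2).2
      rw [← h1] at hw
      rw [h2] at hv
      omega
  have hsum : ∀ F : G.edgeFinset → ℝ, (∀ e, e ∉ Set.range ε → F e = 0) →
      ∑ e, F e = ∑ v : {v // v ≠ r}, F (ε v) := fun F hF =>
    (Fintype.sum_of_injective ε hε _ F hF fun _ => rfl).symm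
  have hsub : ∀ F : V → ℝ, F r = 0 → ∑ v : {v // v ≠ r}, F v.1 = ∑ v, F v := by
    intro F hF
    refine Fintype.sum_of_injective Subtype.val Subtype.val_injective _ F ?_ fun _ => rfl
    intro v hv
    have : v = r := by simpa using hv
    rw [this, hF]
  let c : G.edgeFinset → ℝ := Function.extend ε (fun v => y v.1) 0
  have hcε : ∀ v, c (ε v) = y v.1 := fun v => hε.extend_apply _ _ v
  have hc0 : ∀ e, e ∉ Set.range ε → c e = 0 := fun e he =>
    Function.extend_apply' _ _ e (by simpa using he)
  refine ⟨c, fun v => ?_, ?_⟩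
  · rw [hsum _ fun e he => by rw [hc0 e he, ite_self]]
    have hterm : ∀ w : {v // v ≠ r}, (if v ∈ ((ε w : G.edgeFinset) : Sym2 V) then c (ε w) else 0)
        = (fun w : V => (if v = w then y w else 0) + if w ≠ r ∧ p w = v then y w else 0) w.1 := by
      rintro ⟨w, hw⟩
      have hne := (hp w hw).1.ne
      rw [hcε]
      by_cases e : v = w
      · subst e
        simp [ε, hne.symm]
      · by_cases e' : p w = v
        · simp [ε, e, e', hw]
        · simp [ε, e, e', Ne.symm e']
    rw [Finset.sum_congr rfl fun w _ => hterm w,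
      hsub (fun w : V => (if v = w then y w else 0) + if w ≠ r ∧ p w = v then y w else 0)
        (by simp [hy]), Finset.sum_add_distrib]
    simp
  · unfold norm2
    rw [hsum _ fun e he => by rw [hc0 e he]; norm_num]
    simp_rw [hcε]
    exact hsub (fun v => y v ^ 2) (by simp [hy])

/-- The number of vertices on a cycle is its length. -/
theorem card_support_of_isCycle {W : Type*} [DecidableEq W] {G : SimpleGraph W} {v : W}
    {w : G.Walk v v} (hw : w.IsCycle) :
    w.support.toFinset.card = w.length := by
  have hv : v ∈ w.support.tail := by
    cases w with
    | nil => exact absurd hw (by simp)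
    | cons h q => simp
  have : w.support.toFinset = w.support.tail.toFinset := by
    ext u
    rw [List.mem_toFinset, List.mem_toFinset, SimpleGraph.Walk.mem_support_iff]
    exact ⟨fun hu => hu.elim (fun e => e ▸ hv) id, Or.inr⟩
  rw [this, List.toFinset_card_of_nodup hw.support_nodup, List.length_tail,
    SimpleGraph.Walk.length_support, Nat.add_sub_cancel]

theorem abs_le_kmax {W : Type*} [Finite W] (K : W → ℝ) (v : W) : |K v| ≤ kmax K :=
  le_ciSup (f := fun v => |K v|) (Set.finite_range _).bddAbove v

/-- For a finite simple connected bipartite graph `G` containing a cycle of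
length `g`, with bipartition classes `A` and `B`, and `K : V → ℝ` with `∑_A K = ∑_B K`,
there is a solution `c` of the constraint system for `K` with
`‖c‖₂² ≤ g|V|²‖K‖² + (|V|−g)(|V|−g+1)²‖K‖²` and `‖c‖₂² ≤ |V|·‖K‖₁²`. -/
theorem statement7 (G : SimpleGraph V) (A B : Finset V) (K : V → ℝ) (g : ℕ)
    (hconn : G.Connected)
    (hAB : ∀ v : V, v ∈ A ↔ v ∉ B)
    (hbip : ∀ v w : V, G.Adj v w → ((v ∈ A ∧ w ∈ B) ∨ (v ∈ B ∧ w ∈ A)))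
    (hcyc : ∃ (v : V) (w : G.Walk v v), w.IsCycle ∧ w.length = g)
    (hK : ∑ a ∈ A, K a = ∑ b ∈ B, K b) :
    ∃ c : G.edgeFinset → ℝ, Solves G K c ∧
      norm2 G c ≤ (g : ℝ) * (Fintype.card V : ℝ) ^ 2 * kmax K ^ 2
          + ((Fintype.card V : ℝ) - g) * ((Fintype.card V : ℝ) - g + 1) ^ 2 * kmax K ^ 2 ∧
      norm2 G c ≤ (Fintype.card V : ℝ) * (∑ v, |K v|) ^ 2 := by
  obtain ⟨r, w, hw, rfl⟩ := hcyc
  let C : Finset V := w.support.toFinset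
  have hcard : C.card = w.length := card_support_of_isCycle hw
  have hr : r ∈ C := by simp [C]
  have hCconn : (G.induce (C : Set V)).Connected := by
    have hset : (C : Set V) = {v | v ∈ w.support} := by ext; simp [C]
    rw [hset]
    exact w.connected_induce_support
  obtain ⟨p, h, hp, hpC⟩ := exists_parent hconn hCconn hr
  let σ : V → ℝ := fun v => if v ∈ A then 1 else -1
  have hσsq : ∀ v, σ v * σ v = 1 := fun v => by
    by_cases e : v ∈ A <;> simp [σ, e]
  have hσabs : ∀ v, |σ v| = 1 := fun v => by
    by_cases e : v ∈ A <;> simp [σ, e]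
  have hσadj : ∀ v w, G.Adj v w → σ v = -σ w := by
    intro v w hvw
    rcases hbip v w hvw with ⟨hv, hw⟩ | ⟨hv, hw⟩
    · have : w ∉ A := fun hwA => (hAB w).mp hwA hw
      simp [σ, hv, this]
    · have : v ∉ A := fun hvA => (hAB v).mp hvA hv
      simp [σ, hw, this]
  let x : V → ℝ := fun v => -(σ v * K v)
  have hxabs : ∀ v, |x v| = |K v| := fun v => by simp [x, abs_mul, hσabs]
  have hBA : B = Aᶜ := by
    ext v
    rw [Finset.mem_compl, hAB v, not_not]
  have hx : ∑ v, x v = 0 := by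
    rw [← Finset.sum_add_sum_compl A, ← hBA]
    have h1 : ∑ v ∈ A, x v = -∑ v ∈ A, K v := by
      rw [← Finset.sum_neg_distrib]
      exact Finset.sum_congr rfl fun v hv => by simp [x, σ, hv]
    have h2 : ∑ v ∈ B, x v = ∑ v ∈ B, K v :=
      Finset.sum_congr rfl fun v hv => by
        have : v ∉ A := fun hvA => (hAB v).mp hvA hv
        simp [x, σ, this]
    rw [h1, h2, hK, neg_add_cancel]
  obtain ⟨f, hfr, hfdiv, hf1, hf2⟩ := exists_tree_flow (fun v hv => (hp v hv).2) hpC hr x hx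
  obtain ⟨c, hcsum, hcnorm⟩ := exists_edge_function hp (fun v => σ v * f v) (by simp [hfr])
  have hnorm : norm2 G c = ∑ v, f v ^ 2 := by
    rw [hcnorm]
    refine Finset.sum_congr rfl fun v _ => ?_
    rw [mul_pow, pow_two (σ v), hσsq, one_mul]
  have hsq : ∀ {a b : ℝ}, |a| ≤ b → a ^ 2 ≤ b ^ 2 := fun {a b} hab =>
    sq_le_sq.mpr (hab.trans (le_abs_self b))
  have hk0 : 0 ≤ kmax K := (abs_nonneg _).trans (abs_le_kmax K r)
  have hle : (w.length : ℝ) ≤ Fintype.card V := by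
    rw [← hcard]
    exact_mod_cast Finset.card_le_univ C
  have hsumK : ∀ S : Finset V, ∑ u ∈ S, |x u| ≤ S.card * kmax K := fun S => by
    rw [← nsmul_eq_mul]
    exact Finset.sum_le_card_nsmul _ _ _ fun u _ => (hxabs u).trans_le (abs_le_kmax K u)
  have hcompl : ((Cᶜ).card : ℝ) = Fintype.card V - w.length := by
    rw [Finset.card_compl, Nat.cast_sub (Finset.card_le_univ C), hcard]
  refine ⟨c, fun v => ?_, ?_, ?_⟩
  · have hswap : (∑ w, if w ≠ r ∧ p w = v then σ w * f w else 0)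
        = -(σ v * ∑ w, if w ≠ r ∧ p w = v then f w else 0) := by
      rw [Finset.mul_sum, ← Finset.sum_neg_distrib]
      refine Finset.sum_congr rfl fun u _ => ?_
      split_ifs with hu
      · rw [hσadj u v (hu.2 ▸ (hp u hu.1).1), neg_mul]
      · simp
    rw [hcsum v, hswap, hfdiv v]
    calc _ = σ v * x v := by ring
      _ = -(σ v * σ v * K v) := by ring
      _ = -K v := by rw [hσsq, one_mul]
  · rw [hnorm, ← Finset.sum_add_sum_compl C]
    refine add_le_add ?_ ?_
    · calc ∑ v ∈ C, f v ^ 2 ≤ C.card • (Fintype.card V * kmax K) ^ 2 :=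
            Finset.sum_le_card_nsmul _ _ _ fun v _ =>
              hsq ((hf1 v).trans (hsumK Finset.univ))
        _ = _ := by rw [nsmul_eq_mul, hcard]; ring
    · calc ∑ v ∈ Cᶜ, f v ^ 2
            ≤ (Cᶜ).card • ((Fintype.card V - w.length + 1) * kmax K) ^ 2 := by
            refine Finset.sum_le_card_nsmul _ _ _ fun v hv => hsq ?_
            refine ((hf2 v (Finset.mem_compl.mp hv)).trans (hsumK _)).trans ?_
            rw [hcompl]
            exact mul_le_mul_of_nonneg_right (by linarith) hk0
        _ = _ := by rw [nsmul_eq_mul, hcompl]; ring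
  · rw [hnorm]
    calc ∑ v, f v ^ 2 ≤ (Finset.univ : Finset V).card • (∑ u, |K u|) ^ 2 :=
          Finset.sum_le_card_nsmul _ _ _ fun v _ =>
            hsq ((hf1 v).trans_eq (Finset.sum_congr rfl fun u _ => hxabs u))
      _ = _ := by rw [nsmul_eq_mul, Finset.card_univ]

end CS
end
end

section
/- Let T = (V,E,v) be a finite rooted tree with root v and let K : V → ℝ. Then there is a unique function c : E → ℝ satisfying Σ_{e ∈ I(u)} c(e) = −K(u) for every vertex u ∈ V other than the root. Moreover, this c satisfies: for every u ∈ V, |Σ_{e ∈ I_C(u)} c(e)| ≤ Σ_{w ∈ D(u)∖{u}} |K(w)|, and for every u ∈ V∖{v}, |c(e_p(u))| ≤ Σ_{w ∈ D(u)} |K(w)|. -/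
open scoped Classical
noncomputable section

namespace CS

variable {V : Type*} [Fintype V] [DecidableEq V]

/-- The descendants of `u` in the tree `G` rooted at `v`: the vertices whose
(unique) path to the root `v` passes through `u` (`u` being its own descendant). -/
def descendants (G : SimpleGraph V) (v u : V) : Finset V :=
  Finset.univ.filter fun w => ∀ p : G.Walk w v, p.IsPath → u ∈ p.support

/-- The vertices whose paths to the root `v` all run through the edge `e`. -/
def edgeDescendants (G : SimpleGraph V) (v : V) (e : Sym2 V) : Finset V :=
  Finset.univ.filter fun w => ∀ p : G.Walk w v, p.IsPath → e ∈ p.edges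

section Paths

variable {W : Type*} {T : SimpleGraph W}

lemma eq_of_start_mem_of_mem_edges {u w : W} {p : T.Walk u w} (hp : p.IsPath) {e f : Sym2 W}
    (hue : u ∈ e) (huf : u ∈ f) (he : e ∈ p.edges) (hf : f ∈ p.edges) : e = f := by
  obtain ⟨a, rfl⟩ := hue
  obtain ⟨b, rfl⟩ := huf
  rw [hp.eq_snd_of_mem_edges he, hp.eq_snd_of_mem_edges hf]

lemma isPath_ext (hT : T.IsAcyclic) {u w : W} {p q : T.Walk u w} (hp : p.IsPath)
    (hq : q.IsPath) : p = q :=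
  congrArg Subtype.val ((hT.subsingleton_path u w).elim ⟨p, hp⟩ ⟨q, hq⟩)

lemma mem_edges_of_adj_start (hT : T.IsAcyclic) {u v w : W} {p : T.Walk u v}
    (hp : p.IsPath) (h : T.Adj u w) (hw : w ∈ p.support) : s(u, w) ∈ p.edges := by
  rw [hT.eq_snd_of_adj_start hp h hw]
  apply SimpleGraph.Walk.mk_start_snd_mem_edges
  rintro hnil
  cases hnil
  simp_all

lemma self_mem_descendants [Fintype W] {v u : W} : u ∈ descendants T v u := by
  simp [descendants]

lemma edgeDescendants_subset [Fintype W] {v u : W} {e : Sym2 W} (hu : u ∈ e) :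
    edgeDescendants T v e ⊆ descendants T v u := by
  intro x hx
  simp only [edgeDescendants, descendants, Finset.mem_filter, Finset.mem_univ, true_and] at hx ⊢
  exact fun p hp => SimpleGraph.Walk.mem_support_of_mem_edges (hx p hp) hu

end Paths

variable {T : SimpleGraph V} {v u : V} {K : V → ℝ}

lemma descendants_subset_edgeDescendants (hT : T.IsAcyclic) {p : T.Walk u v} (hp : p.IsPath)
    {e : Sym2 V} (he : e ∈ p.edges) : descendants T v u ⊆ edgeDescendants T v e := by
  intro x hx
  simp only [edgeDescendants, descendants, Finset.mem_filter, Finset.mem_univ, true_and] at hx ⊢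
  intro q hq
  have hu := hx q hq
  rw [isPath_ext hT hp (hq.dropUntil hu)] at he
  exact q.edges_dropUntil_subset_edges hu he

/-- Two distinct edges joining `u` to its children have no common descendants. -/
lemma disjoint_edgeDescendants (hT : T.IsTree) {p : T.Walk u v} (hp : p.IsPath)
    {e f : Sym2 V} (hue : u ∈ e) (huf : u ∈ f) (he : e ∉ p.edges) (hf : f ∉ p.edges)
    (hne : e ≠ f) : Disjoint (edgeDescendants T v e) (edgeDescendants T v f) := by
  rw [Finset.disjoint_left]
  intro x hxe hxf
  simp only [edgeDescendants, Finset.mem_filter, Finset.mem_univ, true_and] at hxe hxf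
  obtain ⟨q, hq, -⟩ := hT.existsUnique_path x v
  have hu : u ∈ q.support := SimpleGraph.Walk.mem_support_of_mem_edges (hxe q hq) hue
  have mem_takeUntil {d : Sym2 V} (hd : d ∈ q.edges) (hdp : d ∉ p.edges) :
      d ∈ (q.takeUntil u hu).reverse.edges := by
    rw [← q.take_spec hu, SimpleGraph.Walk.edges_append, List.mem_append,
      isPath_ext hT.isAcyclic (hq.dropUntil hu) hp] at hd
    simpa [hdp] using hd
  exact hne (eq_of_start_mem_of_mem_edges (hq.takeUntil hu).reverse hue huf
    (mem_takeUntil (hxe q hq) he) (mem_takeUntil (hxf q hq) hf))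

lemma abs_sum_children_le (hT : T.IsTree) {p : T.Walk u v} (hp : p.IsPath)
    {c : T.edgeFinset → ℝ}
    (hc : ∀ e : T.edgeFinset, u ∈ (e : Sym2 V) → (e : Sym2 V) ∉ p.edges →
      |c e| ≤ ∑ w ∈ edgeDescendants T v e, |K w|) :
    |∑ e : T.edgeFinset, (if u ∈ (e : Sym2 V) ∧ (e : Sym2 V) ∉ p.edges then c e else 0)|
      ≤ ∑ w ∈ (descendants T v u).erase u, |K w| := by
  rw [← Finset.sum_filter]
  set F := Finset.univ.filter fun e : T.edgeFinset =>
    u ∈ (e : Sym2 V) ∧ (e : Sym2 V) ∉ p.edges with hF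
  have mem_F {e : T.edgeFinset} : e ∈ F ↔ u ∈ (e : Sym2 V) ∧ (e : Sym2 V) ∉ p.edges := by
    simp [hF]
  calc |∑ e ∈ F, c e| ≤ ∑ e ∈ F, |c e| := Finset.abs_sum_le_sum_abs _ _
    _ ≤ ∑ e ∈ F, ∑ w ∈ edgeDescendants T v e, |K w| :=
        Finset.sum_le_sum fun e he => hc e (mem_F.1 he).1 (mem_F.1 he).2
    _ = ∑ w ∈ F.biUnion fun e => edgeDescendants T v e, |K w| := by
        refine (Finset.sum_biUnion fun e he f hf hne => ?_).symm
        have he := mem_F.1 he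
        have hf := mem_F.1 hf
        exact disjoint_edgeDescendants hT hp he.1 hf.1 he.2 hf.2
          (Subtype.coe_injective.ne hne)
    _ ≤ ∑ w ∈ (descendants T v u).erase u, |K w| := by
        refine Finset.sum_le_sum_of_subset_of_nonneg (fun x hx => ?_) fun _ _ _ => abs_nonneg _
        obtain ⟨e, he, hxe⟩ := Finset.mem_biUnion.1 hx
        have he := mem_F.1 he
        refine Finset.mem_erase.2 ⟨?_, edgeDescendants_subset he.1 hxe⟩
        rintro rfl
        exact he.2 ((Finset.mem_filter.1 hxe).2 p hp)

/-- Every edge lies on the path to the root from one of its ends. -/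
lemma exists_isPath_mem_edges (hT : T.IsTree) (v : V) (e : T.edgeFinset) :
    ∃ u, u ∈ (e : Sym2 V) ∧ ∃ p : T.Walk u v, p.IsPath ∧ (e : Sym2 V) ∈ p.edges := by
  obtain ⟨e, he⟩ := e
  induction e with | _ a b
  have hab : T.Adj a b := by simpa using he
  obtain ⟨p, hp, -⟩ := hT.existsUnique_path a v
  by_cases hb : b ∈ p.support
  · exact ⟨a, by simp, p, hp, mem_edges_of_adj_start hT.isAcyclic hp hab hb⟩
  · exact ⟨b, by simp, .cons hab.symm p, hp.cons hb, by simp⟩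

lemma abs_edge_le (hT : T.IsTree) {c : T.edgeFinset → ℝ}
    (hc : ∀ u : V, u ≠ v →
      ∑ e : T.edgeFinset, (if u ∈ (e : Sym2 V) then c e else 0) = -K u)
    {p : T.Walk u v} (hp : p.IsPath) {e : T.edgeFinset} (hu : u ∈ (e : Sym2 V))
    (he : (e : Sym2 V) ∈ p.edges) : |c e| ≤ ∑ w ∈ edgeDescendants T v e, |K w| := by
  induction hn : Fintype.card V - p.length using Nat.strong_induction_on generalizing u e with
  | _ n ih =>
  have huv : u ≠ v := by
    rintro rfl
    simp [SimpleGraph.Walk.edges_eq_nil.2 (SimpleGraph.Walk.isPath_iff_nil.1 hp)] at he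
  have hchildren := abs_sum_children_le (K := K) (c := c) hT hp <| by
    rintro ⟨f, hfT⟩ huf hf
    obtain ⟨w, rfl⟩ := huf
    have huw : T.Adj u w := by simpa using hfT
    have hw : w ∉ p.support :=
      fun hw => hf (mem_edges_of_adj_start hT.isAcyclic hp huw hw)
    have hlt := hp.length_lt
    refine ih _ ?_ (hp.cons hw (h := huw.symm)) (by simp) (by simp) rfl
    rw [SimpleGraph.Walk.length_cons]
    omega
  have hsum := hc u huv
  have hsplit : ∑ f : T.edgeFinset, (if u ∈ (f : Sym2 V) then c f else 0) =
      c e + ∑ f : T.edgeFinset,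
        (if u ∈ (f : Sym2 V) ∧ (f : Sym2 V) ∉ p.edges then c f else 0) := by
    rw [← Fintype.sum_ite_eq e c, ← Finset.sum_add_distrib]
    refine Finset.sum_congr rfl fun f _ => ?_
    by_cases hef : e = f
    · subst hef
      simp [hu, he]
    · have hf : u ∈ (f : Sym2 V) → (f : Sym2 V) ∉ p.edges := fun huf hf =>
        hef (Subtype.ext (eq_of_start_mem_of_mem_edges hp hu huf he hf))
      by_cases huf : u ∈ (f : Sym2 V)
      · simp [hef, huf, hf huf]
      · simp [hef, huf]
  have hD := Finset.add_sum_erase (descendants T v u) (fun w => |K w|) self_mem_descendants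
  have hDe : ∑ w ∈ descendants T v u, |K w| ≤ ∑ w ∈ edgeDescendants T v e, |K w| :=
    Finset.sum_le_sum_of_subset_of_nonneg
      (descendants_subset_edgeDescendants hT.isAcyclic hp he) fun _ _ _ => abs_nonneg _
  have hce : c e = -K u - ∑ f : T.edgeFinset,
      (if u ∈ (f : Sym2 V) ∧ (f : Sym2 V) ∉ p.edges then c f else 0) := by linarith
  have htri := abs_sub (-K u) (∑ f : T.edgeFinset,
      (if u ∈ (f : Sym2 V) ∧ (f : Sym2 V) ∉ p.edges then c f else 0))
  rw [← hce, abs_neg] at htri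
  linarith

/-- The map sending an edge function to its sums around the non-root vertices. -/
def incidentSum (T : SimpleGraph V) (v : V) : (T.edgeFinset → ℝ) →ₗ[ℝ] ({u // u ≠ v} → ℝ) where
  toFun c u := ∑ e : T.edgeFinset, (if u.1 ∈ (e : Sym2 V) then c e else 0)
  map_add' c d := by
    ext u
    simp only [Pi.add_apply, ← Finset.sum_add_distrib]
    exact Finset.sum_congr rfl fun e _ => by split_ifs <;> simp
  map_smul' r c := by
    ext u
    simp [Finset.mul_sum]

lemma incidentSum_bijective (hT : T.IsTree) (v : V) : Function.Bijective (incidentSum T v) := by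
  have hinj : Function.Injective (incidentSum T v) := by
    rw [injective_iff_map_eq_zero]
    intro c hc
    ext e
    obtain ⟨u, hu, p, hp, he⟩ := exists_isPath_mem_edges hT v e
    have h := abs_edge_le (K := 0) (c := c) hT
      (fun u huv => by simpa [incidentSum] using congrFun hc ⟨u, huv⟩) hp hu he
    simpa using h
  have hcard : Module.finrank ℝ (T.edgeFinset → ℝ) = Module.finrank ℝ ({u // u ≠ v} → ℝ) := by
    have h := hT.card_edgeFinset
    rw [Module.finrank_fintype_fun_eq_card, Module.finrank_fintype_fun_eq_card,
      Fintype.card_coe, Fintype.card_subtype_compl, Fintype.card_subtype_eq]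
    omega
  exact ⟨hinj, (LinearMap.injective_iff_surjective_of_finrank_eq_finrank hcard).1 hinj⟩

/-- For a finite rooted tree `(T, v)` and any `K : V → ℝ` there is a unique
`c` on the edges with `∑_{e ∈ I(u)} c e = -K u` for every non-root vertex `u`; moreover for
every `u`, `|∑_{e ∈ I_C(u)} c e| ≤ ∑_{w ∈ D(u)∖{u}} |K w|` (where `I_C(u)` are the incident
edges not lying on the path from `u` to the root), and for every non-root `u`, the parent edge
`e_p(u)` (the unique edge incident to `u` on the path from `u` to `v`) satisfies
`|c (e_p u)| ≤ ∑_{w ∈ D(u)} |K w|`. -/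
theorem statement11 (T : SimpleGraph V) (v : V) (K : V → ℝ) (htree : T.IsTree) :
    (∃! c : T.edgeFinset → ℝ,
        ∀ u : V, u ≠ v →
          ∑ e : T.edgeFinset, (if u ∈ (e : Sym2 V) then c e else 0) = -K u) ∧
      ∀ c : T.edgeFinset → ℝ,
        (∀ u : V, u ≠ v →
          ∑ e : T.edgeFinset, (if u ∈ (e : Sym2 V) then c e else 0) = -K u) →
        (∀ (u : V) (p : T.Walk u v), p.IsPath →
            |∑ e : T.edgeFinset,
                (if u ∈ (e : Sym2 V) ∧ (e : Sym2 V) ∉ p.edges then c e else 0)|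
              ≤ ∑ w ∈ (descendants T v u).erase u, |K w|) ∧
        (∀ (u : V), u ≠ v → ∀ (p : T.Walk u v), p.IsPath →
            ∀ e : T.edgeFinset, u ∈ (e : Sym2 V) → (e : Sym2 V) ∈ p.edges →
              |c e| ≤ ∑ w ∈ descendants T v u, |K w|) := by
  refine ⟨?_, fun c hc => ⟨fun u p hp => ?_, fun u _ p hp e hu he => ?_⟩⟩
  · obtain ⟨c, hc, huniq⟩ := (incidentSum_bijective htree v).existsUnique fun u => -K u
    exact ⟨c, fun u hu => congrFun hc ⟨u, hu⟩, fun d hd => huniq d (funext fun u => hd u u.2)⟩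
  · refine abs_sum_children_le htree hp fun e hu he => ?_
    obtain ⟨w, hw, q, hq, heq⟩ := exists_isPath_mem_edges htree v e
    exact abs_edge_le htree hc hq hw heq
  · exact (abs_edge_le htree hc hp hu he).trans <|
      Finset.sum_le_sum_of_subset_of_nonneg (edgeDescendants_subset hu) fun _ _ _ => abs_nonneg _

end CS
end
end

section
/- Let ḡ ≥ 6 be even with ḡ/2 odd, let n' ≥ 1 and n = ḡ + 2n', and let G be the graph on vertices {v₁,…,v_ḡ, w₁,…,w_{n'}, t₁,…,t_{n'}} in which v₁,…,v_ḡ form a cycle in this order, each w_i is adjacent to v₁, and each t_i is adjacent to v_{ḡ/2+1} (and there are no other edges). Let K be the constant function K ≡ k for some k > 0. Then the constraint system for K on G has solutions, and the minimum of ‖c‖₂² over all solutions c equals (n − ḡ)·k² + ((ḡ + 2)/32)·k²·(n − ḡ − 2)² + ((ḡ − 2)/32)·k²·(n − ḡ + 2)². -/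
open scoped Classical
noncomputable section

namespace CS

variable {V : Type*} [Fintype V] [DecidableEq V]

/-- The base relation of the bipartite graph from Fig. 5: the vertices `Sum.inl i`,
`i : Fin g`, form a cycle `v₁, …, v_g` in this order, the `n'` vertices
`Sum.inr (Sum.inl _)` (the `w`'s) are attached to `v₁` (index 0), and the `n'` vertices
`Sum.inr (Sum.inr _)` (the `t`'s) are attached to `v_{g/2+1}` (index `g/2`). -/
def twoStarCycleRel (g n' : ℕ) :
    (Fin g ⊕ (Fin n' ⊕ Fin n')) → (Fin g ⊕ (Fin n' ⊕ Fin n')) → Prop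
  | Sum.inl i, Sum.inl j => (j : ℕ) = ((i : ℕ) + 1) % g
  | Sum.inr (Sum.inl _), Sum.inl i => (i : ℕ) = 0
  | Sum.inr (Sum.inr _), Sum.inl i => (i : ℕ) = g / 2
  | _, _ => False

/-- The bipartite unicyclic graph of Fig. 5: a `g`-cycle with `n'` pendant vertices attached
to `v₁` and `n'` pendant vertices attached to `v_{g/2+1}`. -/
def twoStarCycle (g n' : ℕ) : SimpleGraph (Fin g ⊕ (Fin n' ⊕ Fin n')) :=
  SimpleGraph.fromRel (twoStarCycleRel g n')

/-- The target of the unique relation `twoStarCycleRel` issuing from a vertex. -/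
def succVertex (g n' : ℕ) (hg : 6 ≤ g) :
    Fin g ⊕ (Fin n' ⊕ Fin n') → Fin g ⊕ (Fin n' ⊕ Fin n')
  | Sum.inl i => Sum.inl ⟨((i : ℕ) + 1) % g, Nat.mod_lt _ (by omega)⟩
  | Sum.inr (Sum.inl _) => Sum.inl ⟨0, by omega⟩
  | Sum.inr (Sum.inr _) => Sum.inl ⟨g / 2, by omega⟩

lemma twoStarCycleRel_iff {g n' : ℕ} (hg : 6 ≤ g) (x y : Fin g ⊕ (Fin n' ⊕ Fin n')) :
    twoStarCycleRel g n' x y ↔ y = succVertex g n' hg x := by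
  rcases x with i | i | i <;> rcases y with j | j | j <;>
    simp [twoStarCycleRel, succVertex, Fin.ext_iff]

lemma add_one_mod_eq_ite {g i : ℕ} (hi : i < g) :
    (i + 1) % g = if i + 1 = g then 0 else i + 1 := by
  split_ifs with h
  · rw [h, Nat.mod_self]
  · exact Nat.mod_eq_of_lt (by omega)

lemma succVertex_ne {g n' : ℕ} (hg : 6 ≤ g) (x : Fin g ⊕ (Fin n' ⊕ Fin n')) :
    succVertex g n' hg x ≠ x := by
  rcases x with i | i | i
  · simp only [succVertex, ne_eq, Sum.inl.injEq, Fin.ext_iff, add_one_mod_eq_ite i.2]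
    split_ifs <;> omega
  all_goals simp [succVertex]

lemma succVertex_succVertex_ne {g n' : ℕ} (hg : 6 ≤ g) (x : Fin g ⊕ (Fin n' ⊕ Fin n')) :
    succVertex g n' hg (succVertex g n' hg x) ≠ x := by
  rcases x with i | i | i
  · have h := Nat.mod_lt (i + 1 : ℕ) (show 0 < g by omega)
    simp only [succVertex, ne_eq, Sum.inl.injEq, Fin.ext_iff, add_one_mod_eq_ite h]
    rw [add_one_mod_eq_ite i.2]
    split_ifs <;> omega
  all_goals simp [succVertex]

/-- Since the graph is unicyclic, its edges are parametrized by its vertices. -/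
def edgeEquiv (g n' : ℕ) (hg : 6 ≤ g) :
    (Fin g ⊕ (Fin n' ⊕ Fin n')) ≃ (twoStarCycle g n').edgeFinset :=
  Equiv.ofBijective
    (fun x => ⟨s(x, succVertex g n' hg x), by
      rw [SimpleGraph.mem_edgeFinset, SimpleGraph.mem_edgeSet, twoStarCycle,
        SimpleGraph.fromRel_adj, twoStarCycleRel_iff hg]
      exact ⟨(succVertex_ne hg x).symm, Or.inl rfl⟩⟩) <| by
    constructor
    · intro x y h
      rw [Subtype.mk.injEq, Sym2.eq_iff] at h
      rcases h with h | ⟨h₁, h₂⟩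
      · exact h.1
      · rw [h₁] at h₂
        exact absurd h₂ (succVertex_succVertex_ne hg y)
    · rintro ⟨e, he⟩
      induction e with
      | h x y =>
        have hxy := he
        rw [SimpleGraph.mem_edgeFinset, SimpleGraph.mem_edgeSet, twoStarCycle,
          SimpleGraph.fromRel_adj, twoStarCycleRel_iff hg, twoStarCycleRel_iff hg] at hxy
        rcases hxy.2 with h | h
        · exact ⟨x, Subtype.ext (congrArg (fun z => s(x, z)) h.symm)⟩
        · exact ⟨y, Subtype.ext (Sym2.eq_swap.trans (congrArg (fun z => s(z, y)) h.symm))⟩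

lemma coe_edgeEquiv {g n' : ℕ} (hg : 6 ≤ g) (x : Fin g ⊕ (Fin n' ⊕ Fin n')) :
    (edgeEquiv g n' hg x : Sym2 (Fin g ⊕ (Fin n' ⊕ Fin n'))) = s(x, succVertex g n' hg x) :=
  rfl

lemma norm2_eq {g n' : ℕ} (hg : 6 ≤ g) (c : (twoStarCycle g n').edgeFinset → ℝ) :
    norm2 (twoStarCycle g n') c = ∑ x, c (edgeEquiv g n' hg x) ^ 2 :=
  ((edgeEquiv g n' hg).sum_comp fun e => c e ^ 2).symm

lemma solves_iff_succVertex {g n' : ℕ} (hg : 6 ≤ g) (K : Fin g ⊕ (Fin n' ⊕ Fin n') → ℝ)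
    (c : (twoStarCycle g n').edgeFinset → ℝ) :
    Solves (twoStarCycle g n') K c ↔ ∀ v, c (edgeEquiv g n' hg v) +
      ∑ x, (if succVertex g n' hg x = v then c (edgeEquiv g n' hg x) else 0) = -K v := by
  refine forall_congr' fun v => ?_
  rw [← (edgeEquiv g n' hg).sum_comp]
  have key : ∀ x, (if v ∈ (edgeEquiv g n' hg x : Sym2 (Fin g ⊕ (Fin n' ⊕ Fin n')))
        then c (edgeEquiv g n' hg x) else 0) =
      (if x = v then c (edgeEquiv g n' hg x) else 0) +
        (if succVertex g n' hg x = v then c (edgeEquiv g n' hg x) else 0) := by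
    intro x
    rw [coe_edgeEquiv]
    by_cases h₁ : x = v
    · subst h₁
      simp [succVertex_ne hg x]
    · by_cases h₂ : succVertex g n' hg x = v
      · simp [h₁, h₂]
      · simp [h₁, h₂, Ne.symm h₁, Ne.symm h₂]
  simp only [key, Finset.sum_add_distrib, Finset.sum_ite_eq', Finset.mem_univ, if_true]

/-- The constraint system in coordinates: the cycle edges and the pendant edges. -/
lemma solves_iff {g n' : ℕ} (hg : 6 ≤ g) (k : ℝ) (c : (twoStarCycle g n').edgeFinset → ℝ) :
    Solves (twoStarCycle g n') (fun _ => k) c ↔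
      (∀ p, c (edgeEquiv g n' hg (Sum.inr p)) = -k) ∧
      ∀ i : Fin g, c (edgeEquiv g n' hg (succVertex g n' hg (Sum.inl i))) +
        c (edgeEquiv g n' hg (Sum.inl i)) =
        -k + (if (i : ℕ) + 1 = g ∨ (i : ℕ) + 1 = g / 2 then n' * k else 0) := by
  rw [solves_iff_succVertex hg]
  have pendant : ∀ p, (∑ x, if succVertex g n' hg x = Sum.inr p
      then c (edgeEquiv g n' hg x) else 0) = 0 := fun p =>
    Finset.sum_eq_zero fun x _ => if_neg (by rcases x with i | i | i <;> simp [succVertex])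
  have inj : ∀ i j : Fin g, succVertex g n' hg (Sum.inl i) = succVertex g n' hg (Sum.inl j) ↔
      i = j := by
    intro i j
    simp only [succVertex, Sum.inl.injEq, Fin.ext_iff, add_one_mod_eq_ite i.2,
      add_one_mod_eq_ite j.2]
    grind
  have cyc (h : ∀ p, c (edgeEquiv g n' hg (Sum.inr p)) = -k) (i : Fin g) :
      (∑ x, if succVertex g n' hg x = succVertex g n' hg (Sum.inl i)
        then c (edgeEquiv g n' hg x) else 0) = c (edgeEquiv g n' hg (Sum.inl i)) -
        (if (i : ℕ) + 1 = g ∨ (i : ℕ) + 1 = g / 2 then n' * k else 0) := by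
    have hw : ∀ a : Fin n', succVertex g n' hg (Sum.inr (Sum.inl a)) =
        succVertex g n' hg (Sum.inl i) ↔ (i : ℕ) + 1 = g := by
      intro a
      simp only [succVertex, Sum.inl.injEq, Fin.ext_iff, add_one_mod_eq_ite i.2]
      grind
    have ht : ∀ a : Fin n', succVertex g n' hg (Sum.inr (Sum.inr a)) =
        succVertex g n' hg (Sum.inl i) ↔ (i : ℕ) + 1 = g / 2 := by
      intro a
      simp only [succVertex, Sum.inl.injEq, Fin.ext_iff, add_one_mod_eq_ite i.2]
      grind
    simp only [Fintype.sum_sum_type, inj, hw, ht, h, Finset.sum_ite_eq', Finset.mem_univ,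
      if_true, Finset.sum_const, Finset.card_univ, Fintype.card_fin, nsmul_eq_mul]
    by_cases h₁ : (i : ℕ) + 1 = g
    · have h₂ : ¬ (i : ℕ) + 1 = g / 2 := by omega
      simp only [if_pos h₁, if_neg h₂, if_pos (Or.inl h₁ : _ ∨ (i : ℕ) + 1 = g / 2)]
      ring
    · by_cases h₂ : (i : ℕ) + 1 = g / 2
      · simp only [if_neg h₁, if_pos h₂, if_pos (Or.inr h₂ : (i : ℕ) + 1 = g ∨ _)]
        ring
      · simp only [if_neg h₁, if_neg h₂, if_neg (not_or.2 ⟨h₁, h₂⟩)]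
        ring
  constructor
  · intro h
    have hp : ∀ p, c (edgeEquiv g n' hg (Sum.inr p)) = -k := by
      intro p
      have := h (Sum.inr p)
      rwa [pendant, add_zero] at this
    refine ⟨hp, fun i => ?_⟩
    have := h (succVertex g n' hg (Sum.inl i))
    rw [cyc hp] at this
    linarith
  · rintro ⟨hp, h⟩ (j | p)
    · obtain ⟨i, hi⟩ : ∃ i : Fin g, succVertex g n' hg (Sum.inl i) = Sum.inl j := by
        by_cases hj : (j : ℕ) = 0
        · refine ⟨⟨g - 1, by omega⟩, ?_⟩
          simp only [succVertex, Sum.inl.injEq, Fin.ext_iff]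
          rw [add_one_mod_eq_ite (by omega), if_pos (by omega), hj]
        · refine ⟨⟨j - 1, by omega⟩, ?_⟩
          simp only [succVertex, Sum.inl.injEq, Fin.ext_iff]
          rw [add_one_mod_eq_ite (by omega), if_neg (by omega)]
          omega
      rw [← hi, cyc hp]
      linarith [h i]
    · rw [pendant, add_zero, hp]

lemma two_mul_sq_le_of_add_eq {x y a : ℝ} (h : x + y = 2 * a) : 2 * a ^ 2 ≤ x ^ 2 + y ^ 2 := by
  obtain rfl : y = 2 * a - x := by linarith
  nlinarith [sq_nonneg (x - a)]

lemma sum_range_odd_parity (A B : ℝ) (r : ℕ) :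
    ∑ j ∈ Finset.range (2 * r + 1), (if Even j then A else B) = (r + 1) * A + r * B := by
  induction r with
  | zero => simp
  | succ r ih =>
    rw [show 2 * (r + 1) + 1 = 2 * r + 1 + 1 + 1 by ring, Finset.sum_range_succ,
      Finset.sum_range_succ, ih, if_neg (by simp [parity_simps]),
      if_pos (by simp [parity_simps])]
    push_cast
    ring

lemma norm2_eq_of_solves {g n' r : ℕ} (hg : 6 ≤ g) (hr : g = 2 * (2 * r + 1)) {k : ℝ}
    {c : (twoStarCycle g n').edgeFinset → ℝ}
    (hc : ∀ p, c (edgeEquiv g n' hg (Sum.inr p)) = -k) {d : ℕ → ℝ}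
    (hd : ∀ i : Fin g, c (edgeEquiv g n' hg (Sum.inl i)) = d i) :
    norm2 (twoStarCycle g n') c = 2 * n' * k ^ 2 +
      ∑ j ∈ Finset.range (2 * r + 1), (d j ^ 2 + d (2 * r + 1 + j) ^ 2) := by
  rw [norm2_eq hg, Fintype.sum_sum_type]
  simp only [hc, hd]
  rw [Fin.sum_univ_eq_sum_range (fun i => d i ^ 2) g, hr, two_mul (2 * r + 1),
    Finset.sum_range_add, Finset.sum_add_distrib]
  simp
  ring

/-- For even `g ≥ 6` with `g/2` odd, `n' ≥ 1` and `n = g + 2n'`, the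
graph consisting of a `g`-cycle with `n'` pendant vertices at `v₁` and `n'` pendant
vertices at `v_{g/2+1}`, with constant conditioning function `K ≡ k`, `k > 0`: the
constraint system has solutions, and the minimum of `‖c‖₂²` over all solutions equals
`(n−g)k² + ((g+2)/32)k²(n−g−2)² + ((g−2)/32)k²(n−g+2)²`. -/
theorem statement17 (g n' n : ℕ) (hg6 : 6 ≤ g) (hgeven : Even g) (hg2odd : Odd (g / 2))
    (hn' : 1 ≤ n') (hn : n = g + 2 * n') (k : ℝ) (hk : 0 < k) :
    IsLeast {x : ℝ | ∃ c : (twoStarCycle g n').edgeFinset → ℝ,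
        Solves (twoStarCycle g n') (fun _ => k) c ∧ norm2 (twoStarCycle g n') c = x}
      (((n : ℝ) - g) * k ^ 2
        + ((g : ℝ) + 2) / 32 * k ^ 2 * ((n : ℝ) - g - 2) ^ 2
        + ((g : ℝ) - 2) / 32 * k ^ 2 * ((n : ℝ) - g + 2) ^ 2) := by
  obtain ⟨r, hr⟩ := hg2odd
  have hgr : g = 2 * (2 * r + 1) := by
    obtain ⟨m, hm⟩ := hgeven
    omega
  set A : ℝ := (n' - 1) * k / 2 with hA
  set B : ℝ := -((n' + 1) * k / 2) with hB
  have hval : ((n : ℝ) - g) * k ^ 2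
        + ((g : ℝ) + 2) / 32 * k ^ 2 * ((n : ℝ) - g - 2) ^ 2
        + ((g : ℝ) - 2) / 32 * k ^ 2 * ((n : ℝ) - g + 2) ^ 2 =
      2 * n' * k ^ 2 +
        ∑ j ∈ Finset.range (2 * r + 1), (if Even j then 2 * A ^ 2 else 2 * B ^ 2) := by
    rw [sum_range_odd_parity, hn, hA, hB]
    have : (g : ℝ) = 2 * (2 * r + 1) := by exact_mod_cast hgr
    push_cast
    rw [this]
    ring
  rw [hval]
  constructor
  · let d : ℕ → ℝ := fun j =>
      if Even (if j < 2 * r + 1 then j else j - (2 * r + 1)) then A else B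
    let c : (twoStarCycle g n').edgeFinset → ℝ := fun e =>
      Sum.elim (fun i : Fin g => d i) (fun _ => -k) ((edgeEquiv g n' hg6).symm e)
    have hc : ∀ p, c (edgeEquiv g n' hg6 (Sum.inr p)) = -k := fun p => by simp [c]
    have hd : ∀ i : Fin g, c (edgeEquiv g n' hg6 (Sum.inl i)) = d i := fun i => by simp [c]
    refine ⟨c, (solves_iff hg6 k c).2 ⟨hc, fun i => ?_⟩, ?_⟩
    · have hAA : A + A = -k + n' * k := by rw [hA]; ring
      have hAB : A + B = -k := by rw [hA, hB]; ring
      have hi := i.2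
      rw [succVertex, hd, hd, hr]
      simp only [add_one_mod_eq_ite i.2, d]
      by_cases h₁ : (i : ℕ) + 1 = g
      · rw [if_pos h₁, if_pos (by simp), if_pos, if_pos (Or.inl h₁), hAA]
        rw [if_neg (by omega), show (i : ℕ) - (2 * r + 1) = 2 * r by omega]
        exact even_two_mul r
      · by_cases h₂ : (i : ℕ) + 1 = 2 * r + 1
        · have h₃ : (i : ℕ) = 2 * r := by omega
          rw [if_neg h₁]
          simp [h₃, hAA]
        · rw [if_neg h₁, if_neg (not_or.2 ⟨h₁, h₂⟩), add_zero]
          have hpar : Even (if (i : ℕ) + 1 < 2 * r + 1 then (i : ℕ) + 1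
              else (i : ℕ) + 1 - (2 * r + 1)) ↔
              ¬ Even (if (i : ℕ) < 2 * r + 1 then (i : ℕ) else (i : ℕ) - (2 * r + 1)) := by
            simp only [Nat.even_iff]
            split_ifs <;> omega
          simp only [hpar]
          split_ifs <;> linarith
    · rw [norm2_eq_of_solves hg6 hgr hc hd]
      congr 1
      refine Finset.sum_congr rfl fun j hj => ?_
      rw [Finset.mem_range] at hj
      simp only [d, if_pos hj, Nat.add_sub_cancel_left,
        if_neg (show ¬ 2 * r + 1 + j < 2 * r + 1 by omega)]
      split_ifs <;> ring
  · rintro _ ⟨c, hsol, rfl⟩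
    obtain ⟨hc, hcyc⟩ := (solves_iff hg6 k c).1 hsol
    let d : ℕ → ℝ := fun j => if h : j < g then c (edgeEquiv g n' hg6 (Sum.inl ⟨j, h⟩)) else 0
    have hd : ∀ i : Fin g, c (edgeEquiv g n' hg6 (Sum.inl i)) = d i := fun i => by simp [d]
    have hstep : ∀ j, j + 1 < g → d (j + 1) + d j =
        -k + (if j + 1 = 2 * r + 1 then n' * k else 0) := by
      intro j hj
      have := hcyc ⟨j, by omega⟩
      rw [succVertex, hd, hd, hr] at this
      simpa only [Nat.mod_eq_of_lt hj, hj.ne, false_or] using this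
    have hlast : d 0 + d (4 * r + 1) = -k + n' * k := by
      have := hcyc ⟨4 * r + 1, by omega⟩
      rw [succVertex, hd, hd] at this
      simpa only [show 4 * r + 1 + 1 = g by omega, Nat.mod_self, true_or, if_true] using this
    have hmid : d (2 * r + 1) + d (2 * r) = -k + n' * k := by
      simpa using hstep (2 * r) (by omega)
    have hpair : ∀ j, j < 2 * r + 1 → d j + d (2 * r + 1 + j) =
        (d 0 + d (2 * r + 1) + k) * (-1) ^ j - k := by
      intro j
      induction j with
      | zero => intro _; simp
      | succ j ih =>
        intro hj
        have h₁ := hstep j (by omega)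
        have h₂ := hstep (2 * r + 1 + j) (by omega)
        rw [if_neg (by omega)] at h₁ h₂
        rw [pow_succ, ← add_assoc]
        linarith [ih (by omega)]
    have hzero : d 0 + d (2 * r + 1) = 2 * A := by
      have h := hpair (2 * r) (by omega)
      rw [(even_two_mul r).neg_one_pow, show 2 * r + 1 + 2 * r = 4 * r + 1 by ring] at h
      rw [hA]
      linarith
    rw [norm2_eq_of_solves hg6 hgr hc hd]
    gcongr with j hj
    have h := hpair j (Finset.mem_range.1 hj)
    rw [hzero] at h
    split_ifs with hj'
    · rw [hj'.neg_one_pow] at h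
      have h' : d j + d (2 * r + 1 + j) = 2 * A := by linarith
      exact two_mul_sq_le_of_add_eq h'
    · rw [(Nat.not_even_iff_odd.1 hj').neg_one_pow] at h
      have h' : d j + d (2 * r + 1 + j) = 2 * B := by rw [h, hA, hB]; ring
      exact two_mul_sq_le_of_add_eq h'

end CS
end
end
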